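/- arXiv:2303.10814 — 3 statements merged into one kernel-verified Lean document; each statement's English description precedes it below -/
import Mathlib

section
/- For n, m ≥ 1, the number of orbits of the ZMod n-action on the set of (n,m)-Delannoy loops (where c ∈ ZMod n acts by c · [(v, s)] = [(v + (c, 0), s)]) equals D(n, m−1) + D(n−1, m−1). Equivalently, every ZMod n-orbit of (n,m)-Delannoy loops contains a unique representative based at (0,0) whose first step is (0,1) or (1,1). -/
/-- A Delannoy step: `(1,0)`, `(0,1)` or `(1,1)`. -/
def IsDelannoyStep (p : ℕ × ℕ) : Prop :=
  p = (1, 0) ∨ p = (0, 1) ∨ p = (1, 1)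

/-- A based `(n,m)`-loop: a basepoint `v : ZMod n × ZMod m` together with a list of
Delannoy steps whose sum (in `ℕ × ℕ`) is `(n,m)`. -/
def BasedLoop (n m : ℕ) : Type :=
  {b : (ZMod n × ZMod m) × List (ℕ × ℕ) //
    (∀ p ∈ b.2, IsDelannoyStep p) ∧ b.2.sum = (n, m)}

/-- One-step rotation of based loops: `(v, s₀ :: L) ∼ (v + s̄₀, L ++ [s₀])`,
where `s̄₀` is the image of `s₀` in `ZMod n × ZMod m`. -/
def LoopRot (n m : ℕ) (b₁ b₂ : BasedLoop n m) : Prop :=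
  ∃ (v : ZMod n × ZMod m) (s₀ : ℕ × ℕ) (L : List (ℕ × ℕ)),
    b₁.1 = (v, s₀ :: L) ∧
    b₂.1 = (v + ((s₀.1 : ZMod n), (s₀.2 : ZMod m)), L ++ [s₀])

/-- An `(n,m)`-Delannoy loop: an equivalence class of based `(n,m)`-loops under
the equivalence relation generated by rotation. -/
def DelannoyLoop (n m : ℕ) : Type :=
  Quot (LoopRot n m)

/-- The circular Delannoy number `C(n,m)`: the number of `(n,m)`-Delannoy loops. -/
noncomputable def circularDelannoy (n m : ℕ) : ℕ :=
  Nat.card (DelannoyLoop n m)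

/-- Translation of a based loop by `(c,d) ∈ ZMod n × ZMod m`. -/
def BasedLoop.translate {n m : ℕ} (c : ZMod n) (d : ZMod m)
    (b : BasedLoop n m) : BasedLoop n m :=
  ⟨((b.1.1.1 + c, b.1.1.2 + d), b.1.2), b.2⟩
/-- An `(n,m)`-Delannoy path: a list of Delannoy steps whose sum is `(n,m)`. -/
def DelannoyPath (n m : ℕ) : Type :=
  {s : List (ℕ × ℕ) // (∀ p ∈ s, IsDelannoyStep p) ∧ s.sum = (n, m)}

/-- The Delannoy number `D(n,m)`: the number of `(n,m)`-Delannoy paths. -/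
noncomputable def delannoyNumber (n m : ℕ) : ℕ :=
  Nat.card (DelannoyPath n m)

/-- Two based loops lie in the same `ZMod n`-orbit: some translate of the first
by `(c, 0)` is rotation-equivalent to the second. -/
def SameZModOrbit (n m : ℕ) (b₁ b₂ : BasedLoop n m) : Prop :=
  ∃ c : ZMod n,
    (Quot.mk (LoopRot n m) (b₁.translate c 0) : DelannoyLoop n m) =
      Quot.mk (LoopRot n m) b₂

theorem IsDelannoyStep.snd_le_one {p : ℕ × ℕ} (hp : IsDelannoyStep p) : p.2 ≤ 1 := by
  rcases hp with rfl | rfl | rfl <;> simp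

theorem IsDelannoyStep.one_le_add {p : ℕ × ℕ} (hp : IsDelannoyStep p) : 1 ≤ p.1 + p.2 := by
  rcases hp with rfl | rfl | rfl <;> simp

/-- The list `s` begins with a step `(0,1)` or `(1,1)`. -/
def StartsUpward (s : List (ℕ × ℕ)) : Prop :=
  ∃ s₀ L, s = s₀ :: L ∧ (s₀ = (0, 1) ∨ s₀ = (1, 1))

theorem StartsUpward.append {s : List (ℕ × ℕ)} (hs : StartsUpward s) (t : List (ℕ × ℕ)) :
    StartsUpward (s ++ t) := by
  obtain ⟨s₀, L, rfl, h⟩ := hs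
  exact ⟨s₀, L ++ t, rfl, h⟩

theorem StartsUpward.snd_sum_pos {s : List (ℕ × ℕ)} (hs : StartsUpward s) : 0 < s.sum.2 := by
  obtain ⟨s₀, L, rfl, rfl | rfl⟩ := hs <;> simp

theorem StartsUpward.of_append {s t : List (ℕ × ℕ)} (h : StartsUpward (s ++ t)) (hs : s ≠ []) :
    StartsUpward s := by
  obtain ⟨s₀, L, h, h₀⟩ := h
  cases s with
  | nil => exact absurd rfl hs
  | cons p l =>
    rw [List.cons_append, List.cons.injEq] at h
    exact ⟨p, l, rfl, h.1 ▸ h₀⟩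

/-- A list of Delannoy steps climbing above height `k` leaves height `k` by an upward step. -/
theorem exists_eq_append_startsUpward {s : List (ℕ × ℕ)} (hs : ∀ p ∈ s, IsDelannoyStep p) {k : ℕ}
    (hk : k < s.sum.2) : ∃ A B, s = A ++ B ∧ A.sum.2 = k ∧ StartsUpward B := by
  induction s generalizing k with
  | nil => simp at hk
  | cons p L ih =>
    have hp := hs p (by simp)
    have hL : ∀ q ∈ L, IsDelannoyStep q := fun q hq => hs q (by simp [hq])
    rw [List.sum_cons, Prod.snd_add] at hk
    by_cases hpk : p.2 ≤ k
    · by_cases hup : k = 0 ∧ 0 < p.2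
      · omega
      · obtain ⟨A, B, rfl, hA, hB⟩ := ih hL (k := k - p.2) (by omega)
        exact ⟨p :: A, B, rfl, by rw [List.sum_cons, Prod.snd_add]; omega, hB⟩
    · refine ⟨[], p :: L, rfl, ?_, p, L, rfl, ?_⟩
      · have := hp.snd_le_one
        simp only [List.sum_nil, Prod.snd_zero]
        omega
      · rcases hp with rfl | rfl | rfl
        · simp at hpk
        · exact Or.inl rfl
        · exact Or.inr rfl

namespace BasedLoop

variable {n m : ℕ}

/-- `t` is a rotation of the loop `b` that starts in row `0` with an upward step. -/
def IsRowZeroRotation (b : BasedLoop n m) (t : List (ℕ × ℕ)) : Prop :=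
  ∃ A B, b.1.2 = A ++ B ∧ t = B ++ A ∧ StartsUpward B ∧ b.1.1.2 + (A.sum.2 : ZMod m) = 0

theorem exists_isRowZeroRotation [NeZero m] (b : BasedLoop n m) :
    ∃ t, b.IsRowZeroRotation t := by
  obtain ⟨A, B, hs, hA, hB⟩ := exists_eq_append_startsUpward b.2.1
    (k := (-b.1.1.2).val) (by rw [b.2.2]; exact ZMod.val_lt _)
  exact ⟨B ++ A, A, B, hs, rfl, hB, by rw [hA, ZMod.natCast_val, ZMod.cast_id]; simp⟩

theorem eq_nil_of_rows_eq {b : BasedLoop n m} {A C B : List (ℕ × ℕ)}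
    (hs : b.1.2 = A ++ (C ++ B)) (hC : StartsUpward (C ++ B)) (hB : StartsUpward B)
    (hA : b.1.1.2 + (A.sum.2 : ZMod m) = 0) (hAC : b.1.1.2 + ((A ++ C).sum.2 : ZMod m) = 0) :
    C = [] := by
  by_contra hne
  have hpos := (hC.of_append hne).snd_sum_pos
  have hdvd : m ∣ C.sum.2 := by
    rw [← ZMod.natCast_eq_zero_iff]
    rw [List.sum_append, Prod.snd_add, Nat.cast_add, ← add_assoc, hA, zero_add] at hAC
    exact hAC
  have hle := Nat.le_of_dvd hpos hdvd
  have hB' := hB.snd_sum_pos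
  have hsum := congrArg Prod.snd b.2.2
  rw [hs] at hsum
  simp only [List.sum_append, Prod.snd_add] at hsum
  omega

theorem IsRowZeroRotation.unique {b : BasedLoop n m} {t t' : List (ℕ × ℕ)}
    (h : b.IsRowZeroRotation t) (h' : b.IsRowZeroRotation t') : t = t' := by
  obtain ⟨A, B, hs, rfl, hB, hA⟩ := h
  obtain ⟨A', B', hs', rfl, hB', hA'⟩ := h'
  rcases List.append_eq_append_iff.1 (hs.symm.trans hs') with ⟨C, rfl, rfl⟩ | ⟨C, rfl, rfl⟩
  · obtain rfl := eq_nil_of_rows_eq hs hB hB' hA hA'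
    simp
  · obtain rfl := eq_nil_of_rows_eq hs' hB' hB hA' hA
    simp

theorem IsRowZeroRotation.of_loopRot {b b' : BasedLoop n m} (h : LoopRot n m b b')
    {t : List (ℕ × ℕ)} (ht : b.IsRowZeroRotation t) : b'.IsRowZeroRotation t := by
  obtain ⟨v, s₀, L, hb, hb'⟩ := h
  obtain ⟨A, B, hs, rfl, hB, hA⟩ := ht
  have hsum := congrArg Prod.snd b.2.2
  rw [hb] at hs hA hsum
  simp only at hs hA hsum
  cases A with
  | nil =>
    rw [List.nil_append] at hs
    subst hs
    refine ⟨L, [s₀], by rw [hb'], by simp, StartsUpward.of_append (t := L) hB (by simp), ?_⟩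
    rw [hb']
    simp only [List.sum_nil, Prod.snd_zero, Nat.cast_zero, add_zero] at hA
    rw [List.sum_cons, Prod.snd_add] at hsum
    simp only [Prod.snd_add, hA, zero_add]
    rw [← Nat.cast_add, hsum, ZMod.natCast_self]
  | cons p A =>
    rw [List.cons_append, List.cons.injEq] at hs
    obtain ⟨rfl, rfl⟩ := hs
    refine ⟨A, B ++ [s₀], by rw [hb', List.append_assoc], by simp, hB.append _, ?_⟩
    rw [hb', ← hA]
    simp [add_assoc]

theorem isRowZeroRotation_translate {b : BasedLoop n m} {c : ZMod n} {t : List (ℕ × ℕ)} :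
    (b.translate c 0).IsRowZeroRotation t ↔ b.IsRowZeroRotation t := by
  simp [IsRowZeroRotation, translate]

theorem IsRowZeroRotation.startsUpward {b : BasedLoop n m} {t : List (ℕ × ℕ)}
    (h : b.IsRowZeroRotation t) : StartsUpward t := by
  obtain ⟨A, B, -, rfl, hB, -⟩ := h
  exact hB.append A

theorem IsRowZeroRotation.forall_isDelannoyStep {b : BasedLoop n m} {t : List (ℕ × ℕ)}
    (h : b.IsRowZeroRotation t) : ∀ p ∈ t, IsDelannoyStep p := by
  obtain ⟨A, B, hs, rfl, -, -⟩ := h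
  intro p hp
  exact b.2.1 p (by rw [hs]; simp only [List.mem_append] at hp ⊢; exact hp.symm)

theorem IsRowZeroRotation.sum_eq {b : BasedLoop n m} {t : List (ℕ × ℕ)}
    (h : b.IsRowZeroRotation t) : t.sum = (n, m) := by
  obtain ⟨A, B, hs, rfl, -, -⟩ := h
  rw [← b.2.2, hs, List.sum_append, List.sum_append, add_comm]

/-- The rotation of `b` that starts in row `0` with an upward step. -/
noncomputable def rowZeroRotation [NeZero m] (b : BasedLoop n m) : List (ℕ × ℕ) :=
  b.exists_isRowZeroRotation.choose

theorem isRowZeroRotation_rowZeroRotation [NeZero m] (b : BasedLoop n m) :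
    b.IsRowZeroRotation b.rowZeroRotation :=
  b.exists_isRowZeroRotation.choose_spec

theorem rowZeroRotation_eq_iff [NeZero m] {b : BasedLoop n m} {t : List (ℕ × ℕ)} :
    b.rowZeroRotation = t ↔ b.IsRowZeroRotation t :=
  ⟨fun h => h ▸ b.isRowZeroRotation_rowZeroRotation,
    fun h => b.isRowZeroRotation_rowZeroRotation.unique h⟩

theorem rowZeroRotation_eq_of_loopRot [NeZero m] {b b' : BasedLoop n m} (h : LoopRot n m b b') :
    b.rowZeroRotation = b'.rowZeroRotation :=
  (rowZeroRotation_eq_iff.2 (b.isRowZeroRotation_rowZeroRotation.of_loopRot h)).symm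

theorem rowZeroRotation_eq_of_sameZModOrbit [NeZero m] {b b' : BasedLoop n m}
    (h : SameZModOrbit n m b b') : b.rowZeroRotation = b'.rowZeroRotation := by
  obtain ⟨c, hc⟩ := h
  have := congrArg (Quot.lift rowZeroRotation fun _ _ => rowZeroRotation_eq_of_loopRot) hc
  rw [rowZeroRotation_eq_iff, ← isRowZeroRotation_translate (c := c)]
  exact rowZeroRotation_eq_iff.1 this

theorem rowZeroRotation_eq_self [NeZero m] {b : BasedLoop n m} (hb : b.1.1 = 0)
    (hs : StartsUpward b.1.2) : b.rowZeroRotation = b.1.2 :=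
  rowZeroRotation_eq_iff.2 ⟨[], b.1.2, by simp, by simp, hs, by simp [hb]⟩

/-- Rotating a based loop by any prefix of its steps does not change its class. -/
theorem quot_mk_eq_of_append {A B : List (ℕ × ℕ)} {b b' : BasedLoop n m}
    (hs : b.1.2 = A ++ B)
    (hb' : b'.1 = (b.1.1 + ((A.sum.1 : ZMod n), (A.sum.2 : ZMod m)), B ++ A)) :
    (Quot.mk (LoopRot n m) b : DelannoyLoop n m) = Quot.mk (LoopRot n m) b' := by
  induction A generalizing b B with
  | nil =>
    congr 1
    apply Subtype.ext
    rw [hb']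
    ext1
    · simp
    · simp [hs]
  | cons p A ih =>
    let d : BasedLoop n m :=
      ⟨(b.1.1 + ((p.1 : ZMod n), (p.2 : ZMod m)), A ++ (B ++ [p])), by
        intro q hq
        apply b.2.1 q
        rw [hs]
        simp only [List.mem_append, List.mem_cons, List.not_mem_nil, or_false] at hq ⊢
        tauto, by
        refine Eq.trans ?_ b.2.2
        rw [hs]
        simp only [List.sum_append, List.sum_cons, List.sum_nil]
        abel⟩
    have hd : LoopRot n m b d :=
      ⟨b.1.1, p, A ++ B, Prod.ext rfl hs, Prod.ext rfl (List.append_assoc A B [p]).symm⟩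
    refine (Quot.sound hd).trans (ih (b := d) (B := B ++ [p]) rfl ?_)
    rw [hb']
    ext <;> simp [d, add_assoc]

/-- The based loop at the origin following the row-zero rotation of `b`. -/
noncomputable def normalize [NeZero m] (b : BasedLoop n m) : BasedLoop n m :=
  ⟨(0, b.rowZeroRotation), b.isRowZeroRotation_rowZeroRotation.forall_isDelannoyStep,
    b.isRowZeroRotation_rowZeroRotation.sum_eq⟩

theorem sameZModOrbit_normalize [NeZero m] (b : BasedLoop n m) :
    SameZModOrbit n m b b.normalize := by
  obtain ⟨A, B, hs, ht, -, hA⟩ := b.isRowZeroRotation_rowZeroRotation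
  refine ⟨-(b.1.1.1 + (A.sum.1 : ZMod n)), quot_mk_eq_of_append (A := A) (B := B) hs ?_⟩
  refine Prod.ext (Prod.ext ?_ ?_) ht
  · simp [normalize, translate]
  · simp [normalize, translate, hA]

end BasedLoop

/-- Delannoy paths whose first step is upward. -/
def UpwardDelannoyPath (n m : ℕ) : Type :=
  {s : List (ℕ × ℕ) // ((∀ p ∈ s, IsDelannoyStep p) ∧ s.sum = (n, m)) ∧ StartsUpward s}

/-- Orbits of Delannoy loops correspond to Delannoy paths starting with an upward step. -/
noncomputable def orbitEquivUpwardDelannoyPath (n m : ℕ) [NeZero m] :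
    Quot (SameZModOrbit n m) ≃ UpwardDelannoyPath n m where
  toFun := Quot.lift
    (fun b => ⟨b.rowZeroRotation, b.normalize.2,
      b.isRowZeroRotation_rowZeroRotation.startsUpward⟩)
    fun _ _ h => Subtype.ext (BasedLoop.rowZeroRotation_eq_of_sameZModOrbit h)
  invFun t := Quot.mk _ ⟨(0, t.1), t.2.1⟩
  left_inv q := by
    induction q using Quot.ind with
    | mk b => exact (Quot.sound b.sameZModOrbit_normalize).symm
  right_inv t := Subtype.ext
    (BasedLoop.rowZeroRotation_eq_self (b := ⟨(0, t.1), t.2.1⟩) rfl t.2.2)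

/-- Prepending a first step `(0,1)` or `(1,1)` to a Delannoy path. -/
def upwardDelannoyPathOfSum (n m : ℕ) :
    DelannoyPath (n + 1) m ⊕ DelannoyPath n m → UpwardDelannoyPath (n + 1) (m + 1)
  | Sum.inl s => ⟨(0, 1) :: s.1,
      ⟨List.forall_mem_cons.2 ⟨Or.inr (Or.inl rfl), s.2.1⟩,
        by rw [List.sum_cons, s.2.2]; ext <;> simp [add_comm]⟩,
      _, _, rfl, Or.inl rfl⟩
  | Sum.inr s => ⟨(1, 1) :: s.1,
      ⟨List.forall_mem_cons.2 ⟨Or.inr (Or.inr rfl), s.2.1⟩,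
        by rw [List.sum_cons, s.2.2]; ext <;> simp [add_comm]⟩,
      _, _, rfl, Or.inr rfl⟩

theorem upwardDelannoyPathOfSum_bijective (n m : ℕ) :
    Function.Bijective (upwardDelannoyPathOfSum n m) := by
  constructor
  · rintro (s | s) (t | t) h <;> have h := congrArg Subtype.val h <;>
      simp only [upwardDelannoyPathOfSum, List.cons.injEq, Prod.mk.injEq] at h
    · exact congrArg Sum.inl (Subtype.ext h.2)
    · simp at h
    · simp at h
    · exact congrArg Sum.inr (Subtype.ext h.2)
  · rintro ⟨_, ⟨hsteps, hsum⟩, s₀, L, rfl, rfl | rfl⟩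
    all_goals
      have hL := (List.forall_mem_cons.1 hsteps).2
      have h₁ := congrArg Prod.fst hsum
      have h₂ := congrArg Prod.snd hsum
      simp only [List.sum_cons, Prod.fst_add, Prod.snd_add] at h₁ h₂
    · exact ⟨Sum.inl ⟨L, hL, Prod.ext (by grind) (by grind)⟩, rfl⟩
    · exact ⟨Sum.inr ⟨L, hL, Prod.ext (by grind) (by grind)⟩, rfl⟩

theorem length_le_sum_of_isDelannoyStep {s : List (ℕ × ℕ)} (hs : ∀ p ∈ s, IsDelannoyStep p) :
    s.length ≤ s.sum.1 + s.sum.2 := by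
  induction s with
  | nil => simp
  | cons p L ih =>
    obtain ⟨hp, hL⟩ := List.forall_mem_cons.1 hs
    have := hp.one_le_add
    have := ih hL
    simp only [List.length_cons, List.sum_cons, Prod.fst_add, Prod.snd_add]
    omega

instance finite_delannoyPath (n m : ℕ) : Finite (DelannoyPath n m) := by
  have : Finite {p // IsDelannoyStep p} :=
    ((Set.toFinite {(1, 0), (0, 1), (1, 1)}).subset fun p hp => hp)
  refine Set.Finite.subset ((List.finite_length_le {p // IsDelannoyStep p} (n + m)).image
    (List.map Subtype.val)) (t := {s | (∀ p ∈ s, IsDelannoyStep p) ∧ s.sum = (n, m)}) ?_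
  rintro s ⟨hs, hsum⟩
  have hlen := length_le_sum_of_isDelannoyStep hs
  rw [hsum] at hlen
  lift s to List {p // IsDelannoyStep p} using hs
  exact ⟨s, by simpa using hlen, rfl⟩

/-- For `n, m ≥ 1`, the number of orbits of the `ZMod n`-action
`c • [(v, s)] = [(v + (c, 0), s)]` on `(n,m)`-Delannoy loops equals
`D(n, m−1) + D(n−1, m−1)`; equivalently, every orbit contains a unique
representative based at `(0,0)` whose first step is `(0,1)` or `(1,1)`. -/
theorem zmod_orbits_of_delannoyLoops (n m : ℕ) (hn : 1 ≤ n) (hm : 1 ≤ m) :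
    Nat.card (Quot (SameZModOrbit n m)) =
        delannoyNumber n (m - 1) + delannoyNumber (n - 1) (m - 1) ∧
      ∀ b : BasedLoop n m, ∃! b' : BasedLoop n m,
        (b'.1.1 = 0 ∧ ∃ s₀ L, b'.1.2 = s₀ :: L ∧ (s₀ = (0, 1) ∨ s₀ = (1, 1))) ∧
          SameZModOrbit n m b b' := by
  have : NeZero m := ⟨by omega⟩
  constructor
  · obtain ⟨n, rfl⟩ := Nat.exists_eq_add_of_le' hn
    obtain ⟨m, rfl⟩ := Nat.exists_eq_add_of_le' hm
    rw [Nat.card_congr (orbitEquivUpwardDelannoyPath (n + 1) (m + 1)),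
      ← Nat.card_congr (Equiv.ofBijective _ (upwardDelannoyPathOfSum_bijective n m)),
      Nat.card_sum]
    rfl
  · intro b
    refine ⟨b.normalize, ⟨⟨rfl, b.isRowZeroRotation_rowZeroRotation.startsUpward⟩,
      b.sameZModOrbit_normalize⟩, ?_⟩
    rintro b' ⟨⟨h₀, hup⟩, horb⟩
    refine Subtype.ext (Prod.ext h₀ ?_)
    rw [← BasedLoop.rowZeroRotation_eq_self h₀ hup]
    exact (BasedLoop.rowZeroRotation_eq_of_sameZModOrbit horb).symm
end

section
/- Let n ≥ 1 and let c ∈ S^{{n+1}}; for 1 ≤ k ≤ n+1 let I_k = {x ∈ S | sbtw(c_k, x, c_{k+1})} ∪ {c_{k+1}} (the half-open arc (c_k, c_{k+1}], indices mod n+1), so that S is the disjoint union of I_1, …, I_{n+1}. Let ψ_J : S^{{n}} → ℚ be the indicator function of the set {x ∈ S^{{n}} | x_k ∈ I_k for all 1 ≤ k ≤ n}, and ψ_I : S^{{n+1}} → ℚ the indicator function of {x ∈ S^{{n+1}} | x_k ∈ I_k for all 1 ≤ k ≤ n+1}. Let σ denote the cyclic shift σ(x_1,…,x_k) = (x_k,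 x_1, …, x_{k−1}) on tuples, and set θ_J = Σ_{i=0}^{n−1} ((−1)^{n+1})^i · (ψ_J ∘ σ^i) and θ_I = Σ_{i=0}^{n} ((−1)^{n+2})^i · (ψ_I ∘ σ^i). Define d_n(φ) = Σ_{i=1}^{n+1} (−1)^{i+1} · (φ ∘ p_i) for φ : S^{{n}} → ℚ, where p_i : S^{{n+1}} → S^{{n}} deletes the i-th coordinate. Then d_n(θ_J) = (−1)^n · θ_I. -/
/-- The circle `S = ℝ/ℤ`. -/
abbrev Circle' : Type := AddCircle (1 : ℝ)

/-- `y` lies strictly between `x` and `z` in the cyclic order on the circle: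
there are lifts `x̃ < ỹ < z̃ < x̃ + 1`. -/
def Sbtw' (x y z : Circle') : Prop :=
  ∃ a b c : ℝ, (a : Circle') = x ∧ (b : Circle') = y ∧ (c : Circle') = z ∧
    a < b ∧ b < c ∧ c < a + 1

/-- A bijection of the circle preserves the cyclic order. -/
def PreservesCyclicOrder (g : Equiv.Perm Circle') : Prop :=
  ∀ x y z : Circle', Sbtw' x y z ↔ Sbtw' (g x) (g y) (g z)

/-- Membership in `S^{{n}}`: the tuple admits lifts `t 0 < t 1 < ⋯ < t (n-1) < t 0 + 1`. -/
def CyclicallyOrdered {n : ℕ} (x : Fin n → Circle') : Prop :=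
  ∃ t : Fin n → ℝ, (∀ i, (t i : Circle') = x i) ∧ StrictMono t ∧ ∀ i j, t i < t j + 1

/-- The half-open arc `I_k = (c_k, c_{k+1}]` determined by a cyclically ordered
tuple `c` (indices mod the length of `c`). -/
def arcOf {N : ℕ} (c : Fin (N + 1) → Circle') (k : Fin (N + 1)) : Set Circle' :=
  {x | Sbtw' (c k) x (c (k + 1))} ∪ {c (k + 1)}

/-- The cyclic shift `σ(x₁,…,x_k) = (x_k, x₁, …, x_{k−1})` on tuples. -/
def cycShift {N : ℕ} (y : Fin (N + 1) → Circle') : Fin (N + 1) → Circle' :=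
  fun j => y (j - 1)

/-- The indicator function (with values in `ℚ`) of the set of tuples whose `k`-th
coordinate lies in the `k`-th member of a family of subsets of the circle. -/
noncomputable def prodIndicator {k : ℕ} (A : Fin k → Set Circle') :
    (Fin k → Circle') → ℚ :=
  Set.indicator {x : Fin k → Circle' | ∀ i, x i ∈ A i} 1

theorem coe_eq_coe_iff_exists_add_intCast (a b : ℝ) :
    (a : Circle') = (b : Circle') ↔ ∃ z : ℤ, a = b + z := by
  rw [← sub_eq_zero, ← AddCircle.coe_sub, AddCircle.coe_eq_zero_iff]
  constructor
  · rintro ⟨z, hz⟩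
    exact ⟨z, by rw [zsmul_eq_mul, mul_one] at hz; linarith⟩
  · rintro ⟨z, hz⟩
    exact ⟨z, by rw [zsmul_eq_mul, mul_one]; linarith⟩

/-- Two lifts of the same point that are less than `1` apart coincide. -/
theorem eq_of_coe_eq_of_abs_sub_lt {a b : ℝ} (h : (a : Circle') = (b : Circle'))
    (h₁ : a < b + 1) (h₂ : b < a + 1) : a = b := by
  obtain ⟨z, hz⟩ := (coe_eq_coe_iff_exists_add_intCast a b).1 h
  have hz₁ : z < 1 := by
    have : (z : ℝ) < 1 := by linarith
    exact_mod_cast this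
  have hz₂ : -1 < z := by
    have : (-1 : ℝ) < z := by linarith
    exact_mod_cast this
  obtain rfl : z = 0 := by omega
  simpa using hz

/-- The lift of the endpoint `c (k + 1)` that follows the lift `s k` of `c k`. -/
noncomputable def nextLift {m : ℕ} (s : Fin (m + 2) → ℝ) (k : Fin (m + 2)) : ℝ :=
  if k = Fin.last (m + 1) then s 0 + 1 else s (k + 1)

section Arcs

variable {m : ℕ} {c : Fin (m + 2) → Circle'} {s : Fin (m + 2) → ℝ}

theorem coe_nextLift (hs : ∀ i, (s i : Circle') = c i) (k : Fin (m + 2)) :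
    (nextLift s k : Circle') = c (k + 1) := by
  unfold nextLift
  split_ifs with h
  · subst h
    rw [Fin.last_add_one, ← hs 0, coe_eq_coe_iff_exists_add_intCast]
    exact ⟨1, by simp⟩
  · exact hs _

theorem nextLift_le (hm : StrictMono s) {k l : Fin (m + 2)} (h : k < l) :
    nextLift s k ≤ s l := by
  have hk : k ≠ Fin.last (m + 1) := (h.trans_le (Fin.le_last l)).ne
  rw [nextLift, if_neg hk]
  exact hm.monotone (Fin.add_one_le_of_lt h)

theorem nextLift_le_add_one (hw : ∀ i j, s i < s j + 1) (k : Fin (m + 2)) :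
    nextLift s k ≤ s 0 + 1 := by
  unfold nextLift
  split_ifs
  · exact le_rfl
  · exact (hw _ _).le

theorem lt_nextLift (hm : StrictMono s) (hw : ∀ i j, s i < s j + 1) (k : Fin (m + 2)) :
    s k < nextLift s k := by
  unfold nextLift
  split_ifs with h
  · exact hw _ _
  · exact hm (Fin.lt_add_one_iff.2 (Fin.lt_last_iff_ne_last.2 h))

theorem nextLift_lt_add_one (hm : StrictMono s) (hw : ∀ i j, s i < s j + 1)
    (k : Fin (m + 2)) : nextLift s k < s k + 1 := by
  unfold nextLift
  split_ifs with h
  · subst h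
    have := hm (Fin.last_pos (n := m))
    linarith
  · exact hw _ _

theorem mem_arcOf_iff (hs : ∀ i, (s i : Circle') = c i) (hm : StrictMono s)
    (hw : ∀ i j, s i < s j + 1) (k : Fin (m + 2)) (p : Circle') :
    p ∈ arcOf c k ↔ ∃ r : ℝ, (r : Circle') = p ∧ s k < r ∧ r ≤ nextLift s k := by
  have h₁ := lt_nextLift hm hw k
  have h₂ := nextLift_lt_add_one hm hw k
  constructor
  · rintro (⟨a, b, d, ha, rfl, hd, hab, hbd, hda⟩ | rfl)
    · rw [← hs k, coe_eq_coe_iff_exists_add_intCast] at ha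
      obtain ⟨z, rfl⟩ := ha
      have hdz : d - z = nextLift s k := by
        apply eq_of_coe_eq_of_abs_sub_lt _ (by linarith) (by linarith)
        rw [coe_nextLift hs, ← hd, coe_eq_coe_iff_exists_add_intCast]
        exact ⟨-z, by push_cast; ring⟩
      refine ⟨b - z, ?_, by linarith, by linarith⟩
      rw [coe_eq_coe_iff_exists_add_intCast]
      exact ⟨-z, by push_cast; ring⟩
    · exact ⟨nextLift s k, coe_nextLift hs k, h₁, le_rfl⟩
  · rintro ⟨r, rfl, hr₁, hr₂⟩
    rcases hr₂.eq_or_lt with rfl | hr₂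
    · exact Or.inr (coe_nextLift hs k)
    · exact Or.inl ⟨s k, r, nextLift s k, hs k, rfl, coe_nextLift hs k, hr₁, hr₂, h₂⟩

end Arcs

/-- The arcs cut out by a cyclically ordered tuple partition the circle. -/
theorem existsUnique_mem_arcOf {m : ℕ} {c : Fin (m + 2) → Circle'}
    (hc : CyclicallyOrdered c) (p : Circle') : ∃! k, p ∈ arcOf c k := by
  obtain ⟨s, hs, hm, hw⟩ := hc
  simp only [mem_arcOf_iff hs hm hw]
  refine existsUnique_of_exists_of_unique ?_ ?_
  · obtain ⟨r, ⟨hr₁, hr₂⟩, rfl⟩ : p ∈ ((↑) : ℝ → Circle') '' Set.Ioc (s 0) (s 0 + 1) := by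
      rw [AddCircle.coe_image_Ioc_eq]
      trivial
    have hne : (Finset.univ.filter fun k => s k < r).Nonempty := ⟨0, by simpa using hr₁⟩
    obtain ⟨k, hk⟩ := (Finset.univ.filter fun k => s k < r).exists_maximal hne
    have hkr : s k < r := by simpa using hk.1
    refine ⟨k, r, rfl, hkr, ?_⟩
    unfold nextLift
    split_ifs with h
    · exact hr₂
    · by_contra! hlt
      have := hk.2 (show k + 1 ∈ _ by simpa using hlt)
        (Fin.lt_add_one_iff.2 (Fin.lt_last_iff_ne_last.2 h)).le
      exact this.not_gt (Fin.lt_add_one_iff.2 (Fin.lt_last_iff_ne_last.2 h))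
  · rintro k l ⟨r, hr, hr₁, hr₂⟩ ⟨r', hr', hr'₁, hr'₂⟩
    have hk := hm.monotone (Fin.zero_le k)
    have hl := hm.monotone (Fin.zero_le l)
    have hk' := nextLift_le_add_one hw k
    have hl' := nextLift_le_add_one hw l
    obtain rfl : r = r' :=
      eq_of_coe_eq_of_abs_sub_lt (hr.trans hr'.symm) (by linarith) (by linarith)
    rcases lt_trichotomy k l with h | h | h
    · have := nextLift_le hm h
      linarith
    · exact h
    · have := nextLift_le hm h
      linarith

theorem CyclicallyOrdered.cycShift {N : ℕ} {y : Fin (N + 1) → Circle'}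
    (hy : CyclicallyOrdered y) : CyclicallyOrdered (cycShift y) := by
  obtain ⟨t, ht, hm, hw⟩ := hy
  refine ⟨Fin.cons (t (Fin.last N) - 1) fun j : Fin N => t j.castSucc, ?_, ?_, ?_⟩
  · refine Fin.cases ?_ fun j => ?_
    · have h : (0 : Fin (N + 1)) - 1 = Fin.last N := by
        rw [sub_eq_iff_eq_add, Fin.last_add_one]
      rw [Fin.cons_zero, _root_.cycShift, h, ← ht, coe_eq_coe_iff_exists_add_intCast]
      exact ⟨-1, by push_cast; ring⟩
    · have h : j.succ - 1 = j.castSucc := by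
        rw [sub_eq_iff_eq_add, Fin.coeSucc_eq_succ]
      rw [Fin.cons_succ, _root_.cycShift, h, ht]
  · refine Fin.cases (Fin.cases ?_ fun j => ?_) fun i => Fin.cases ?_ fun j => ?_
    · intro h
      exact absurd h (lt_irrefl _)
    · intro _
      have := hw (Fin.last N) j.castSucc
      simp only [Fin.cons_zero, Fin.cons_succ]
      linarith
    · intro h
      exact absurd h (Fin.not_lt_zero _)
    · intro h
      simpa using hm (Fin.castSucc_lt_castSucc_iff.2 (Fin.succ_lt_succ_iff.1 h))
  · refine Fin.cases (Fin.cases ?_ fun j => ?_) fun i => Fin.cases ?_ fun j => ?_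
    · simp
    · have := hw (Fin.last N) j.castSucc
      simp only [Fin.cons_zero, Fin.cons_succ]
      linarith
    · have := hm (Fin.castSucc_lt_last i)
      simp only [Fin.cons_zero, Fin.cons_succ]
      linarith
    · simpa using hw i.castSucc j.castSucc

theorem CyclicallyOrdered.iterate_cycShift {N : ℕ} {y : Fin (N + 1) → Circle'}
    (hy : CyclicallyOrdered y) (i : ℕ) : CyclicallyOrdered (_root_.cycShift^[i] y) := by
  induction i with
  | zero => exact hy
  | succ i ih =>
    rw [Function.iterate_succ_apply']
    exact ih.cycShift

theorem CyclicallyOrdered.comp_strictMono {N N' : ℕ} {x : Fin N → Circle'}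
    (hx : CyclicallyOrdered x) {f : Fin N' → Fin N} (hf : StrictMono f) :
    CyclicallyOrdered (x ∘ f) := by
  obtain ⟨t, ht, hm, hw⟩ := hx
  exact ⟨t ∘ f, fun i => ht _, hm.comp hf, fun i j => hw _ _⟩

theorem inv_finRotate_apply {N : ℕ} (j : Fin (N + 1)) : (finRotate (N + 1))⁻¹ j = j - 1 := by
  rw [Equiv.Perm.inv_eq_iff_eq, finRotate_apply, sub_add_cancel]

theorem iterate_cycShift_eq_comp {N : ℕ} (y : Fin (N + 1) → Circle') (i : ℕ) :
    cycShift^[i] y = y ∘ ((finRotate (N + 1))⁻¹ ^ i : Equiv.Perm (Fin (N + 1))) := by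
  induction i generalizing y with
  | zero => rfl
  | succ i ih =>
    rw [Function.iterate_succ_apply, ih]
    funext j
    rw [Function.comp_apply, Function.comp_apply, pow_succ', Equiv.Perm.mul_apply,
      inv_finRotate_apply, cycShift]

open Classical in
/-- The matrix of indicators `[y j ∈ A k]`. -/
noncomputable def indicatorMatrix {N : ℕ} (A : Fin N → Set Circle') (y : Fin N → Circle') :
    Matrix (Fin N) (Fin N) ℚ :=
  Matrix.of fun j k => if y j ∈ A k then 1 else 0

theorem prodIndicator_eq_prod {N : ℕ} (A : Fin N → Set Circle') (y : Fin N → Circle')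
    (π : Equiv.Perm (Fin N)) :
    prodIndicator A (y ∘ π) = ∏ k, indicatorMatrix A y (π k) k := by
  classical
  simp [prodIndicator, indicatorMatrix, Set.indicator_apply, Finset.prod_ite_zero]

/-- If a cyclically ordered tuple visits successive arcs in the order `π`, starting with `π 0 = 0`,
then `π` is the identity. -/
theorem eq_one_of_mem_arcOf {m N : ℕ} {c : Fin (m + 2) → Circle'} (hc : CyclicallyOrdered c)
    {f : Fin (N + 1) → Fin (m + 2)} (hf : StrictMono f) {y : Fin (N + 1) → Circle'}
    (hy : CyclicallyOrdered y) {π : Equiv.Perm (Fin (N + 1))} (hπ₀ : π 0 = 0)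
    (hπ : ∀ k, y (π k) ∈ arcOf c (f k)) : π = 1 := by
  obtain ⟨s, hs, hm, hw⟩ := hc
  obtain ⟨t, ht, htm, htw⟩ := hy
  simp only [mem_arcOf_iff hs hm hw] at hπ
  choose u hu hu₁ hu₂ using hπ
  have hum : StrictMono u := fun k l h =>
    ((hu₂ k).trans (nextLift_le hm (hf h))).trans_lt (hu₁ l)
  have h₀ := hu 0
  rw [hπ₀, ← ht, coe_eq_coe_iff_exists_add_intCast] at h₀
  obtain ⟨z, hz⟩ := h₀
  have hut : ∀ k, u k = t (π k) + z := fun k => by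
    have h₁ := hum.monotone (Fin.zero_le k)
    have h₂ := htm.monotone (Fin.zero_le (π k))
    have h₃ := htw (π k) 0
    have h₄ := (hu₂ k).trans (nextLift_le_add_one hw _)
    have h₅ := (hm.monotone (Fin.zero_le _)).trans_lt (hu₁ 0)
    apply eq_of_coe_eq_of_abs_sub_lt _ (by linarith) (by linarith)
    rw [hu, ← ht, coe_eq_coe_iff_exists_add_intCast]
    exact ⟨-z, by push_cast; ring⟩
  have hπm : StrictMono π := fun k l h => by
    have := hum h
    rw [hut, hut] at this
    exact htm.lt_iff_lt.1 (by linarith)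
  ext k
  have := Subsingleton.elim
    (StrictMono.orderIsoOfSurjective π hπm π.surjective) (OrderIso.refl _)
  exact congrArg Fin.val (DFunLike.congr_fun this k)

theorem inv_finRotate_pow_apply {N : ℕ} (i : ℕ) (k : Fin (N + 1)) :
    ((finRotate (N + 1))⁻¹ ^ i) k = k - Fin.ofNat (N + 1) i := by
  induction i with
  | zero => simp
  | succ i ih =>
    rw [pow_succ', Equiv.Perm.mul_apply, ih, inv_finRotate_apply, sub_sub]
    congr 1
    ext
    simp [Fin.val_add]

theorem eq_inv_finRotate_pow_of_mem_arcOf {m N : ℕ} {c : Fin (m + 2) → Circle'}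
    (hc : CyclicallyOrdered c) {f : Fin (N + 1) → Fin (m + 2)} (hf : StrictMono f)
    {y : Fin (N + 1) → Circle'} (hy : CyclicallyOrdered y) {π : Equiv.Perm (Fin (N + 1))}
    (hπ : ∀ k, y (π k) ∈ arcOf c (f k)) :
    π = (finRotate (N + 1))⁻¹ ^ ((-π 0 : Fin (N + 1)) : ℕ) := by
  set ρ := (finRotate (N + 1))⁻¹ ^ ((-π 0 : Fin (N + 1)) : ℕ) with hρ
  have hρ₀ : ρ 0 = π 0 := by
    rw [hρ, inv_finRotate_pow_apply, Fin.ofNat_val_eq_self]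
    simp
  have hy' := hy.iterate_cycShift ((-π 0 : Fin (N + 1)) : ℕ)
  rw [iterate_cycShift_eq_comp, ← hρ] at hy'
  have h : ρ⁻¹ * π = 1 :=
    eq_one_of_mem_arcOf hc hf hy' (by simp [← hρ₀]) fun k => by simpa using hπ k
  exact (inv_mul_eq_one.1 h).symm

/-- On cyclically ordered tuples, the signed sum over cyclic shifts is a determinant. -/
theorem sum_prodIndicator_iterate_cycShift_eq_det {m N : ℕ} {c : Fin (m + 2) → Circle'}
    (hc : CyclicallyOrdered c) {f : Fin (N + 1) → Fin (m + 2)} (hf : StrictMono f)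
    {y : Fin (N + 1) → Circle'} (hy : CyclicallyOrdered y) :
    ∑ i ∈ Finset.range (N + 1), ((-1 : ℚ) ^ (N + 1 + 1)) ^ i *
      prodIndicator (fun k => arcOf c (f k)) (cycShift^[i] y) =
    (indicatorMatrix (fun k => arcOf c (f k)) y).det := by
  rw [Matrix.det_apply']
  refine Finset.sum_of_injOn (fun i => (finRotate (N + 1))⁻¹ ^ i) ?_ (by simp) ?_ ?_
  · intro i hi j hj hij
    have h := DFunLike.congr_fun hij 0
    simp only [inv_finRotate_pow_apply, sub_right_inj] at h
    have h' := congrArg Fin.val h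
    simp only [Finset.coe_range, Set.mem_Iio] at hi hj
    rwa [Fin.val_ofNat, Fin.val_ofNat, Nat.mod_eq_of_lt hi, Nat.mod_eq_of_lt hj] at h'
  · intro π _ hπ
    rw [← prodIndicator_eq_prod, prodIndicator, Set.indicator_of_notMem, mul_zero]
    intro h
    exact hπ ⟨_, by simp [Fin.is_le], (eq_inv_finRotate_pow_of_mem_arcOf hc hf hy h).symm⟩
  · intro i _
    rw [← prodIndicator_eq_prod, iterate_cycShift_eq_comp]
    congr 1
    simp [sign_finRotate, pow_succ]

theorem sum_indicatorMatrix_arcOf {m : ℕ} {c : Fin (m + 2) → Circle'}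
    (hc : CyclicallyOrdered c) (x : Fin (m + 2) → Circle') (j : Fin (m + 2)) :
    ∑ k, indicatorMatrix (arcOf c) x j k = 1 := by
  obtain ⟨k, hk, hu⟩ := existsUnique_mem_arcOf hc (x j)
  rw [Finset.sum_eq_single k]
  · simp [indicatorMatrix, hk]
  · intro l _ hl
    simpa [indicatorMatrix] using fun h => hl (hu l h)
  · simp

/-- Expansion along the last column of a square matrix whose rows sum to `1`. -/
theorem det_eq_sum_of_row_sum_eq_one {n : ℕ} (M : Matrix (Fin (n + 1)) (Fin (n + 1)) ℚ)
    (hM : ∀ i, ∑ k, M i k = 1) :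
    M.det = ∑ i : Fin (n + 1),
      (-1 : ℚ) ^ ((i : ℕ) + n) * (M.submatrix i.succAbove Fin.castSucc).det := by
  have h := Matrix.det_updateCol_sum M (Fin.last n) (fun _ => (1 : ℚ))
  simp only [one_smul] at h
  rw [← h, Matrix.det_succ_column _ (Fin.last n)]
  refine Finset.sum_congr rfl fun i _ => ?_
  have hsub : (M.updateCol (Fin.last n) fun _ => 1).submatrix i.succAbove Fin.castSucc =
      M.submatrix i.succAbove Fin.castSucc := by
    ext j k
    simp [(Fin.castSucc_lt_last k).ne]
  simp [hM, hsub, Fin.succAbove_last]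

/-- Lemma 6.4 of the paper (with `n = m + 1 ≥ 1`): let `c ∈ S^{{n+1}}` cut the
circle into half-open arcs `I_1, …, I_{n+1}`, let `ψ_J : S^{{n}} → ℚ` and
`ψ_I : S^{{n+1}} → ℚ` be the indicator functions of `I_1 × ⋯ × I_n` and
`I_1 × ⋯ × I_{n+1}`, and let
`θ_J = Σ_{i=0}^{n−1} ((−1)^{n+1})^i (ψ_J ∘ σ^i)`,
`θ_I = Σ_{i=0}^{n} ((−1)^{n+2})^i (ψ_I ∘ σ^i)`,
`d_n(φ) = Σ_{i=1}^{n+1} (−1)^{i+1} (φ ∘ p_i)`.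
Then `d_n(θ_J) = (−1)^n θ_I` on `S^{{n+1}}`. -/
theorem dn_thetaJ_eq_thetaI
    (m : ℕ) (c : Fin (m + 2) → Circle') (hc : CyclicallyOrdered c) :
    let n : ℕ := m + 1
    let ψJ : (Fin (m + 1) → Circle') → ℚ :=
      prodIndicator (fun k : Fin (m + 1) => arcOf c k.castSucc)
    let ψI : (Fin (m + 2) → Circle') → ℚ :=
      prodIndicator (fun k : Fin (m + 2) => arcOf c k)
    let θJ : (Fin (m + 1) → Circle') → ℚ :=
      fun y => ∑ i ∈ Finset.range n, ((-1 : ℚ) ^ (n + 1)) ^ i * ψJ (cycShift^[i] y)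
    let θI : (Fin (m + 2) → Circle') → ℚ :=
      fun y => ∑ i ∈ Finset.range (n + 1), ((-1 : ℚ) ^ (n + 2)) ^ i * ψI (cycShift^[i] y)
    ∀ x : Fin (m + 2) → Circle', CyclicallyOrdered x →
      ∑ i : Fin (m + 2), (-1 : ℚ) ^ (i : ℕ) * θJ (x ∘ i.succAbove) =
        (-1 : ℚ) ^ n * θI x := by
  intro n ψJ ψI θJ θI x hx
  have hJ : ∀ i : Fin (m + 2), θJ (x ∘ i.succAbove) =
      ((indicatorMatrix (arcOf c) x).submatrix i.succAbove Fin.castSucc).det := fun i =>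
    sum_prodIndicator_iterate_cycShift_eq_det hc (Fin.strictMono_castSucc)
      (hx.comp_strictMono (Fin.strictMono_succAbove i))
  have hI : θI x = (indicatorMatrix (arcOf c) x).det :=
    sum_prodIndicator_iterate_cycShift_eq_det hc strictMono_id hx
  rw [hI, det_eq_sum_of_row_sum_eq_one _ (sum_indicatorMatrix_arcOf hc x), Finset.mul_sum]
  refine Finset.sum_congr rfl fun i _ => ?_
  rw [hJ, ← mul_assoc, ← pow_add, show n + ((i : ℕ) + (m + 1)) = i + 2 * n by omega, pow_add,
    pow_mul]
  simp
end

section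
/- Let n ≥ 1 and let c ∈ S^{{n+1}}; for 1 ≤ k ≤ n+1 let I_k = {x ∈ S | sbtw(c_k, x, c_{k+1})} ∪ {c_{k+1}} (the half-open arc (c_k, c_{k+1}], indices mod n+1), so that S is the disjoint union of I_1, …, I_{n+1}. Let ψ_J : S^{{n}} → ℚ be the indicator function of the set {x ∈ S^{{n}} | x_k ∈ I_k for all 1 ≤ k ≤ n}, let σ denote the cyclic shift σ(x_1,…,x_k) = (x_k, x_1, …, x_{k−1}) on tuples, set θ_J = Σ_{i=0}^{n−1} ((−1)^{n+1})^i · (ψ_J ∘ σ^i), and define α : S^{{n+1}} → ℚ by α = Σ_{i=1}^{n+1} (−1)^{i+1} · (θ_J ∘ p_i), where p_i : S^{{n+1}} → S^{{n}} deletes the i-th coordinate. Then: (i) if x ∈ S^{{n+1}} satisfies x_k ∈ I_k for all 1 ≤ k ≤ n+1, then α(x) = (−1)^n; and (ii) if x ∈ S^{{n+1}} has two distinct coordinates lying in the same arc I_j, then α(x) = 0. -/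
/-- The signed sum of a product indicator over all cyclic shifts of the argument. -/
noncomputable def cyclicIndicatorSum {m : ℕ} (A : Fin (m + 1) → Set Circle')
    (y : Fin (m + 1) → Circle') : ℚ :=
  ∑ i ∈ Finset.range (m + 1), ((-1 : ℚ) ^ (m + 2)) ^ i * prodIndicator A (cycShift^[i] y)

theorem cycShift_iterate_apply {N : ℕ} (y : Fin (N + 1) → Circle') (i : ℕ) (j : Fin (N + 1)) :
    (cycShift^[i] y) j = y (j - Fin.ofNat (N + 1) i) := by
  induction i generalizing j with
  | zero =>
    have h : Fin.ofNat (N + 1) 0 = 0 := rfl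
    rw [h, sub_zero, Function.iterate_zero_apply]
  | succ i ih =>
    rw [Function.iterate_succ_apply', cycShift, ih]
    have h : Fin.ofNat (N + 1) (i + 1) = 1 + Fin.ofNat (N + 1) i := by
      ext
      simp [Fin.val_add, add_comm]
    rw [sub_sub, h]

theorem prodIndicator_congr {k : ℕ} {A : Fin k → Set Circle'} {y z : Fin k → Circle'}
    (h : ∀ i j, y i ∈ A j ↔ z i ∈ A j) : prodIndicator A y = prodIndicator A z := by
  classical
  simp only [prodIndicator, Set.indicator_apply, Set.mem_ofPred_eq, h, Pi.one_apply]

theorem prodIndicator_eq_zero {k : ℕ} {A : Fin k → Set Circle'} {y : Fin k → Circle'}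
    (h : ¬ ∀ i, y i ∈ A i) : prodIndicator A y = 0 :=
  Set.indicator_of_notMem (by simpa using h) _

section CyclicIndicatorSum

variable {m : ℕ} {A : Fin (m + 1) → Set Circle'} {y z : Fin (m + 1) → Circle'}

theorem cyclicIndicatorSum_congr (h : ∀ i j, y i ∈ A j ↔ z i ∈ A j) :
    cyclicIndicatorSum A y = cyclicIndicatorSum A z := by
  refine Finset.sum_congr rfl fun i _ => ?_
  congr 1
  refine prodIndicator_congr fun k l => ?_
  simp only [cycShift_iterate_apply, h]

theorem cyclicIndicatorSum_eq_zero_of_forall_notMem {a : Fin (m + 1)} (h : ∀ k, y a ∉ A k) :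
    cyclicIndicatorSum A y = 0 := by
  refine Finset.sum_eq_zero fun i _ => ?_
  rw [prodIndicator_eq_zero, mul_zero]
  intro hy
  have := hy (a + Fin.ofNat (m + 1) i)
  rw [cycShift_iterate_apply, add_sub_cancel_right] at this
  exact h _ this

theorem cyclicIndicatorSum_eq_zero_of_ne {a b : Fin (m + 1)} (hab : a ≠ b)
    (h : ∀ k l, y a ∈ A k → y b ∈ A l → k = l) :
    cyclicIndicatorSum A y = 0 := by
  refine Finset.sum_eq_zero fun i _ => ?_
  rw [prodIndicator_eq_zero, mul_zero]
  intro hy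
  have h₁ := hy (a + Fin.ofNat (m + 1) i)
  have h₂ := hy (b + Fin.ofNat (m + 1) i)
  rw [cycShift_iterate_apply, add_sub_cancel_right] at h₁ h₂
  exact hab (add_right_cancel (h _ _ h₁ h₂))

theorem cyclicIndicatorSum_cycShift :
    cyclicIndicatorSum A (cycShift y) = (-1 : ℚ) ^ (m + 2) * cyclicIndicatorSum A y := by
  have hs : ((-1 : ℚ) ^ (m + 2)) ^ (m + 1) = 1 := by
    rw [← pow_mul]
    exact Even.neg_one_pow (by rw [mul_comm]; exact Nat.even_mul_succ_self (m + 1))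
  have hper : cycShift^[m + 1] y = y := by
    funext j
    have h : Fin.ofNat (m + 1) (m + 1) = 0 := by ext; simp
    rw [cycShift_iterate_apply, h, sub_zero]
  have hsq : (-1 : ℚ) ^ (m + 2) * (-1 : ℚ) ^ (m + 2) = 1 := by
    rw [← mul_pow]; simp
  have hstep : (-1 : ℚ) ^ (m + 2) * cyclicIndicatorSum A (cycShift y) =
      cyclicIndicatorSum A y := by
    have e := (Finset.sum_range_succ (fun i =>
      ((-1 : ℚ) ^ (m + 2)) ^ i * prodIndicator A (cycShift^[i] y)) (m + 1)).symm.trans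
      (Finset.sum_range_succ' (fun i =>
        ((-1 : ℚ) ^ (m + 2)) ^ i * prodIndicator A (cycShift^[i] y)) (m + 1))
    simp only [hs, hper, pow_zero, Function.iterate_zero, id_eq] at e
    rw [cyclicIndicatorSum, cyclicIndicatorSum, add_right_cancel e, Finset.mul_sum]
    refine Finset.sum_congr rfl fun i _ => ?_
    rw [Function.iterate_succ_apply, pow_succ']
    ring
  rw [← hstep, ← mul_assoc, hsq, one_mul]

theorem cyclicIndicatorSum_eq_one (hA : ∀ i j, y i ∈ A j ↔ i = j) :
    cyclicIndicatorSum A y = 1 := by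
  rw [cyclicIndicatorSum, Finset.sum_eq_single 0]
  · have : ∀ i, y i ∈ A i := fun i => (hA i i).2 rfl
    simp [prodIndicator, this]
  · intro i hi hi0
    rw [prodIndicator_eq_zero, mul_zero]
    intro hy
    have h := (hA _ _).1 (cycShift_iterate_apply y i 0 ▸ hy 0)
    rw [zero_sub, neg_eq_zero, Fin.ext_iff, Fin.val_ofNat, Fin.val_zero,
      Nat.mod_eq_of_lt (Finset.mem_range.1 hi)] at h
    exact hi0 h
  · simp

end CyclicIndicatorSum

theorem exists_int_of_coe_eq {a b : ℝ} (h : (a : Circle') = b) : ∃ p : ℤ, a = b + p := by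
  rw [← sub_eq_zero, ← AddCircle.coe_sub, AddCircle.coe_eq_zero_iff] at h
  obtain ⟨p, hp⟩ := h
  exact ⟨p, by rw [zsmul_one] at hp; linarith⟩

theorem coe_add_int (a : ℝ) (p : ℤ) : ((a + p : ℝ) : Circle') = a := by
  rw [AddCircle.coe_add, add_eq_left, AddCircle.coe_eq_zero_iff]
  exact ⟨p, by simp⟩

theorem eq_of_coe_eq_of_lt {a b : ℝ} (h : (a : Circle') = b) (h₁ : a < b + 1) (h₂ : b < a + 1) :
    a = b := by
  obtain ⟨p, rfl⟩ := exists_int_of_coe_eq h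
  have h₃ : p < 1 := by exact_mod_cast (by linarith : (p : ℝ) < 1)
  have h₄ : -1 < p := by exact_mod_cast (by linarith : (-1 : ℝ) < p)
  obtain rfl : p = 0 := by omega
  simp

/-- The half-open arcs cut out by a cyclically ordered tuple lift to the half-open intervals
between consecutive lifts of the endpoints. -/
theorem CyclicallyOrdered.exists_arcOf_iff {m : ℕ} {c : Fin (m + 2) → Circle'}
    (hc : CyclicallyOrdered c) :
    ∃ t t' : Fin (m + 2) → ℝ, (∀ k l, k < l → t' k ≤ t l) ∧ (∀ k l, t' k ≤ t l + 1) ∧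
      ∀ k x, x ∈ arcOf c k ↔ ∃ s : ℝ, (s : Circle') = x ∧ t k < s ∧ s ≤ t' k := by
  obtain ⟨t, htc, hmono, ht⟩ := hc
  let t' : Fin (m + 2) → ℝ := fun k => if k = Fin.last (m + 1) then t 0 + 1 else t (k + 1)
  have hlast : t' (Fin.last (m + 1)) = t 0 + 1 := if_pos rfl
  have hne : ∀ k, k ≠ Fin.last (m + 1) → t' k = t (k + 1) := fun k hk => if_neg hk
  have hlift : ∀ k, (t' k : Circle') = c (k + 1) := by
    intro k
    by_cases hk : k = Fin.last (m + 1)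
    · subst hk
      rw [hlast, AddCircle.coe_add_period, htc, Fin.last_add_one]
    · rw [hne k hk, htc]
  have hlt : ∀ k, t k < t' k := by
    intro k
    by_cases hk : k = Fin.last (m + 1)
    · subst hk
      rw [hlast]
      exact ht _ _
    · rw [hne k hk]
      exact hmono (Fin.lt_add_one_iff.2 (Fin.lt_last_iff_ne_last.2 hk))
  have hlt' : ∀ k, t' k < t k + 1 := by
    intro k
    by_cases hk : k = Fin.last (m + 1)
    · subst hk
      rw [hlast]
      linarith [hmono (Fin.last_pos (n := m))]
    · rw [hne k hk]
      exact ht _ _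
  refine ⟨t, t', ?_, ?_, ?_⟩
  · intro k l hkl
    have hk : k ≠ Fin.last (m + 1) := (hkl.trans_le (Fin.le_last l)).ne
    rw [hne k hk]
    exact hmono.monotone (Fin.add_one_le_of_lt hkl)
  · intro k l
    by_cases hk : k = Fin.last (m + 1)
    · subst hk
      rw [hlast]
      linarith [hmono.monotone (Fin.zero_le l)]
    · rw [hne k hk]
      exact (ht _ _).le
  · intro k x
    constructor
    · rintro (⟨a, b, d, ha, hb, hd, hab, hbd, hda⟩ | hx)
      · obtain ⟨p, rfl⟩ := exists_int_of_coe_eq (ha.trans (htc k).symm)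
        have hd' : d - p = t' k := by
          refine eq_of_coe_eq_of_lt ?_ (by linarith [hlt k]) (by linarith [hlt' k])
          rw [hlift, ← hd, ← coe_add_int (d - p) p, sub_add_cancel]
        refine ⟨b - p, ?_, by linarith, by linarith⟩
        rw [← hb, ← coe_add_int (b - p) p, sub_add_cancel]
      · exact ⟨t' k, (hlift k).trans hx.symm, hlt k, le_rfl⟩
    · rintro ⟨s, rfl, h₁, h₂⟩
      rcases h₂.lt_or_eq with h₂ | rfl
      · exact Or.inl ⟨t k, s, t' k, htc k, rfl, hlift k, h₁, h₂, hlt' k⟩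
      · exact Or.inr (hlift k)

theorem CyclicallyOrdered.eq_of_mem_arcOf {m : ℕ} {c : Fin (m + 2) → Circle'}
    (hc : CyclicallyOrdered c) {x : Circle'} {k l : Fin (m + 2)} (hk : x ∈ arcOf c k)
    (hl : x ∈ arcOf c l) : k = l := by
  obtain ⟨t, t', h₁, h₂, h⟩ := hc.exists_arcOf_iff
  wlog hkl : k < l generalizing k l
  · rcases (not_lt.1 hkl).lt_or_eq with hlk | rfl
    · exact (this hl hk hlk).symm
    · rfl
  obtain ⟨s, hs, hs₁, hs₂⟩ := (h _ _).1 hk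
  obtain ⟨s', hs', hs₁', hs₂'⟩ := (h _ _).1 hl
  have := h₁ k l hkl
  have := h₂ l k
  have := eq_of_coe_eq_of_lt (hs.trans hs'.symm) (by linarith) (by linarith)
  linarith

/-- Of two points of a cyclically ordered tuple separating two others that lie in a common arc,
one lies in that arc. -/
theorem CyclicallyOrdered.mem_arcOf_or_mem_arcOf {m n : ℕ} {c : Fin (m + 2) → Circle'}
    (hc : CyclicallyOrdered c) {x : Fin n → Circle'} (hx : CyclicallyOrdered x)
    {j : Fin (m + 2)} {k₁ k₂ l l' : Fin n} (h₁ : x k₁ ∈ arcOf c j) (h₂ : x k₂ ∈ arcOf c j)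
    (hl₁ : k₁ < l) (hl₂ : l < k₂) (hl' : l' < k₁ ∨ k₂ < l') :
    x l ∈ arcOf c j ∨ x l' ∈ arcOf c j := by
  obtain ⟨t, t', -, ht, h⟩ := hc.exists_arcOf_iff
  obtain ⟨u, hux, hmono, hu⟩ := hx
  obtain ⟨b, hb, hb₁, hb₂⟩ := (h _ _).1 h₁
  obtain ⟨d, hd, hd₁, hd₂⟩ := (h _ _).1 h₂
  obtain ⟨p, rfl⟩ := exists_int_of_coe_eq (hb.trans (hux k₁).symm)
  obtain ⟨q, rfl⟩ := exists_int_of_coe_eq (hd.trans (hux k₂).symm)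
  have hj := ht j j
  have hu₁ := hmono hl₁
  have hu₂ := hmono hl₂
  have hu₃ := hu k₂ k₁
  have hq₁ : q < p + 1 := by exact_mod_cast (by linarith : (q : ℝ) < p + 1)
  have hq₂ : p < q + 2 := by exact_mod_cast (by linarith : (p : ℝ) < q + 2)
  obtain rfl | rfl : p = q ∨ p = q + 1 := by omega
  · exact Or.inl ((h _ _).2 ⟨u l + p, by rw [coe_add_int, hux], by linarith, by linarith⟩)
  · push_cast at hb₁ hb₂
    right
    rcases hl' with hl' | hl'
    · have := hmono hl'
      have := hu k₂ l'
      exact (h _ _).2 ⟨u l' + (q + 1 : ℤ), by rw [coe_add_int, hux],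
        by push_cast; linarith, by push_cast; linarith⟩
    · have := hmono hl'
      have := hu l' k₁
      exact (h _ _).2 ⟨u l' + q, by rw [coe_add_int, hux], by linarith, by linarith⟩

/-- Parts (a) and (b) of Lemma 6.4's proof (with `n = m + 1 ≥ 1`): let
`c ∈ S^{{n+1}}` cut the circle into half-open arcs `I_1, …, I_{n+1}`, let
`ψ_J : S^{{n}} → ℚ` be the indicator function of `I_1 × ⋯ × I_n`, let
`θ_J = Σ_{i=0}^{n−1} ((−1)^{n+1})^i (ψ_J ∘ σ^i)` and
`α = Σ_{i=1}^{n+1} (−1)^{i+1} (θ_J ∘ p_i)`. Then for `x ∈ S^{{n+1}}`: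
(i) if `x_k ∈ I_k` for all `k`, then `α(x) = (−1)^n`; and
(ii) if two distinct coordinates of `x` lie in the same arc `I_j`, then
`α(x) = 0`. -/
theorem alpha_values
    (m : ℕ) (c : Fin (m + 2) → Circle') (hc : CyclicallyOrdered c) :
    let n : ℕ := m + 1
    let ψJ : (Fin (m + 1) → Circle') → ℚ :=
      prodIndicator (fun k : Fin (m + 1) => arcOf c k.castSucc)
    let θJ : (Fin (m + 1) → Circle') → ℚ :=
      fun y => ∑ i ∈ Finset.range n, ((-1 : ℚ) ^ (n + 1)) ^ i * ψJ (cycShift^[i] y)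
    let α : (Fin (m + 2) → Circle') → ℚ :=
      fun x => ∑ i : Fin (m + 2), (-1 : ℚ) ^ (i : ℕ) * θJ (x ∘ i.succAbove)
    ∀ x : Fin (m + 2) → Circle', CyclicallyOrdered x →
      ((∀ k : Fin (m + 2), x k ∈ arcOf c k) → α x = (-1 : ℚ) ^ n) ∧
      ((∃ k₁ k₂ : Fin (m + 2), k₁ ≠ k₂ ∧ ∃ j : Fin (m + 2),
          x k₁ ∈ arcOf c j ∧ x k₂ ∈ arcOf c j) → α x = 0) := by
  intro n ψJ θJ α x hx
  have hα : α x = ∑ i : Fin (m + 2), (-1 : ℚ) ^ (i : ℕ) *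
      cyclicIndicatorSum (fun k : Fin (m + 1) => arcOf c k.castSucc) (x ∘ i.succAbove) := rfl
  rw [hα]
  constructor
  · intro h
    have hiff : ∀ k l, x k ∈ arcOf c l ↔ k = l := fun k l =>
      ⟨fun hkl => hc.eq_of_mem_arcOf (h k) hkl, fun hkl => hkl ▸ h k⟩
    rw [Fintype.sum_eq_single (Fin.last (m + 1)), cyclicIndicatorSum_eq_one, mul_one, Fin.val_last]
    · intro i j
      simp [hiff]
    · intro i hi
      obtain ⟨a, ha⟩ := Fin.exists_succAbove_eq hi.symm
      rw [cyclicIndicatorSum_eq_zero_of_forall_notMem (a := a), mul_zero]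
      intro k
      rw [Function.comp_apply, ha, hiff]
      exact (Fin.castSucc_ne_last k).symm
  · rintro ⟨k₁, k₂, hne, j, h₁, h₂⟩
    have key : ∀ i a b : Fin (m + 2), a ≠ i → b ≠ i → a ≠ b → x a ∈ arcOf c j →
        x b ∈ arcOf c j → cyclicIndicatorSum (fun k : Fin (m + 1) => arcOf c k.castSucc)
          (x ∘ i.succAbove) = 0 := by
      intro i a b hai hbi hab ha hb
      obtain ⟨a, rfl⟩ := Fin.exists_succAbove_eq hai
      obtain ⟨b, rfl⟩ := Fin.exists_succAbove_eq hbi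
      refine cyclicIndicatorSum_eq_zero_of_ne (a := a) (b := b) (fun h => hab (h ▸ rfl)) ?_
      intro k l hk hl
      exact Fin.castSucc_injective _
        ((hc.eq_of_mem_arcOf hk ha).trans (hc.eq_of_mem_arcOf hl hb).symm)
    wlog hlt : k₁ < k₂ generalizing k₁ k₂
    · exact this k₂ k₁ hne.symm h₂ h₁ (lt_of_le_of_ne (not_lt.1 hlt) hne.symm)
    have hsame : ∀ k, x k₁ ∈ arcOf c k ↔ x k₂ ∈ arcOf c k := fun k =>
      ⟨fun hk => hc.eq_of_mem_arcOf h₁ hk ▸ h₂, fun hk => hc.eq_of_mem_arcOf h₂ hk ▸ h₁⟩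
    have hother : ∀ i, i ≠ k₁ ∧ i ≠ k₂ → (-1 : ℚ) ^ (i : ℕ) *
        cyclicIndicatorSum (fun k : Fin (m + 1) => arcOf c k.castSucc) (x ∘ i.succAbove) = 0 :=
      fun i hi => by rw [key i k₁ k₂ hi.1.symm hi.2.symm hne h₁ h₂, mul_zero]
    by_cases hsucc : (k₂ : ℕ) = k₁ + 1
    · rw [Fintype.sum_eq_add k₁ k₂ hne hother, cyclicIndicatorSum_congr (z := x ∘ k₂.succAbove),
        hsucc]
      · ring
      · intro i k
        have hi : k₁.succAbove i = k₂.succAbove i ∨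
            k₁.succAbove i = k₂ ∧ k₂.succAbove i = k₁ := by
          simp only [Fin.succAbove, Fin.ext_iff, Fin.lt_def]
          split_ifs <;> simp_all <;> omega
        rcases hi with hi | ⟨hi₁, hi₂⟩
        · simp only [Function.comp_apply, hi]
        · simp only [Function.comp_apply, hi₁, hi₂, hsame]
    by_cases hends : k₁ = 0 ∧ k₂ = Fin.last (m + 1)
    · obtain ⟨rfl, rfl⟩ := hends
      rw [Fintype.sum_eq_add _ _ hne hother,
        cyclicIndicatorSum_congr (y := x ∘ (Fin.last (m + 1)).succAbove)
          (z := cycShift (x ∘ (0 : Fin (m + 2)).succAbove)), cyclicIndicatorSum_cycShift,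
        ← mul_assoc, ← pow_add, Fin.val_last, Fin.val_zero,
        Odd.neg_one_pow (n := m + 1 + (m + 2)) ⟨m + 1, by ring⟩]
      · ring
      · intro i k
        cases m with
        | zero =>
          obtain rfl : i = 0 := Fin.ext (by omega)
          simpa [cycShift] using hsame k.castSucc
        | succ m =>
          refine Fin.cases ?_ (fun i => ?_) i
          · have : (0 : Fin (m + 2)) - 1 = Fin.last (m + 1) := by
              rw [sub_eq_iff_eq_add, Fin.last_add_one]
            simpa [cycShift, this] using hsame k.castSucc
          · have : i.succ - 1 = i.castSucc := by
              rw [sub_eq_iff_eq_add, Fin.coeSucc_eq_succ]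
            simp [cycShift, this]
    · obtain ⟨l, hl₁, hl₂⟩ : ∃ l, k₁ < l ∧ l < k₂ :=
        ⟨⟨k₁ + 1, by omega⟩, by simp [Fin.lt_def], by rw [Fin.lt_def] at hlt ⊢; dsimp; omega⟩
      obtain ⟨l', hl'⟩ : ∃ l', l' < k₁ ∨ k₂ < l' := by
        by_contra! hcon
        exact hends ⟨Fin.le_zero_iff.1 (hcon 0).1, Fin.last_le_iff.1 (hcon (Fin.last _)).2⟩
      obtain ⟨a, ha₁, ha₂, ha⟩ : ∃ a, a ≠ k₁ ∧ a ≠ k₂ ∧ x a ∈ arcOf c j := by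
        rcases hc.mem_arcOf_or_mem_arcOf hx h₁ h₂ hl₁ hl₂ hl' with h | h
        · exact ⟨l, hl₁.ne', hl₂.ne, h⟩
        · rcases hl' with hl' | hl'
          · exact ⟨l', hl'.ne, (hl'.trans hlt).ne, h⟩
          · exact ⟨l', (hlt.trans hl').ne', hl'.ne', h⟩
      refine Finset.sum_eq_zero fun i _ => ?_
      by_cases hi₁ : i = k₁
      · subst hi₁
        rw [key i a k₂ ha₁ hne.symm ha₂ ha h₂, mul_zero]
      by_cases hi₂ : i = k₂
      · subst hi₂
        rw [key i a k₁ ha₂ hne ha₁ ha h₁, mul_zero]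
      exact hother i ⟨hi₁, hi₂⟩
end
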